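/- arXiv:2412.02079 — 5 statements merged into one kernel-verified Lean document; each statement's English description precedes it below -/
import Mathlib

section
/- Suppose f : ℝⁿ → ℝ is twice continuously differentiable with locally Lipschitz second derivative (every point of ℝⁿ has a neighborhood on which x ↦ ∇²f(x) is Lipschitz in operator norm), and suppose σ ∈ (0, β]. Then for any σ-CAT trajectory, either lim_{k→∞} ε_k = 0 or lim_{k→∞} f(x_k) = −∞. -/
open scoped RealInnerProductSpace
open Filter

noncomputable section

/-- Application of the Hessian-based quadratic model's gradient:
`∇M_x(d) = ∇²f(x) d + ∇f(x)`. -/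
def gradModel {n : ℕ} (f : EuclideanSpace ℝ (Fin n) → ℝ)
    (x d : EuclideanSpace ℝ (Fin n)) : EuclideanSpace ℝ (Fin n) :=
  fderiv ℝ (gradient f) x d + gradient f x

/-- The quadratic model `M_x(d) = (1/2) dᵀ ∇²f(x) d + ∇f(x)ᵀ d`. -/
def modelVal {n : ℕ} (f : EuclideanSpace ℝ (Fin n) → ℝ)
    (x d : EuclideanSpace ℝ (Fin n)) : ℝ :=
  (1/2) * ⟪fderiv ℝ (gradient f) x d, d⟫ + ⟪gradient f x, d⟫

/-- The ratio `ρ̂` of actual to (modified) predicted reduction; equals `0` when the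
denominator is `0` (division by zero convention). -/
def rhoHat {n : ℕ} (θ : ℝ) (f : EuclideanSpace ℝ (Fin n) → ℝ)
    (x d : EuclideanSpace ℝ (Fin n)) : ℝ :=
  (f x - f (x + d)) /
    (-(modelVal f x d) + (θ/2) * min ‖gradient f x‖ ‖gradient f (x + d)‖ * ‖d‖)

/-- A σ-CAT trajectory (Algorithm 1): as a CAT trajectory, but a step is accepted only
when additionally `ρ̂_k ≥ σ`. -/
structure SigmaCATTraj {n : ℕ} (θ β ω₁ ω₂ γ₁ γ₂ γ₃ ξ σ : ℝ)
    (f : EuclideanSpace ℝ (Fin n) → ℝ)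
    (x d : ℕ → EuclideanSpace ℝ (Fin n))
    (r δ ε : ℕ → ℝ) (b : ℕ → EReal) : Prop where
  hf : ∀ y, DifferentiableAt ℝ f y
  hf' : ∀ y, DifferentiableAt ℝ (gradient f) y
  r_pos : ∀ k, 1 ≤ k → 0 < r k
  δ_nonneg : ∀ k, 1 ≤ k → 0 ≤ δ k
  ε_pos : ∀ k, 1 ≤ k → 0 < ε k
  b_pos : ∀ k, 1 ≤ k → 0 < b k
  sub_grad : ∀ k, 1 ≤ k → ‖gradModel f (x k) (d k) + δ k • d k‖ ≤ γ₁ * ε k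
  sub_comp : ∀ k, 1 ≤ k → γ₂ * δ k * r k ≤ δ k * ‖d k‖
  sub_rad : ∀ k, 1 ≤ k → ‖d k‖ ≤ r k
  sub_decr : ∀ k, 1 ≤ k → modelVal f (x k) (d k) ≤ -(γ₃ * (δ k / 2) * ‖d k‖ ^ 2)
  step_acc : ∀ k, 1 ≤ k →
    (f (x k + d k) ≤ f (x k) ∧ σ ≤ rhoHat θ f (x k) (d k)) → x (k+1) = x k + d k
  step_rej : ∀ k, 1 ≤ k →
    ¬ (f (x k + d k) ≤ f (x k) ∧ σ ≤ rhoHat θ f (x k) (d k)) → x (k+1) = x k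
  radius_succ : ∀ k, 1 ≤ k → β ≤ rhoHat θ f (x k) (d k) →
    r (k+1) = max (ω₂ * ‖d k‖) (r k)
  radius_fail : ∀ k, 1 ≤ k → ¬ β ≤ rhoHat θ f (x k) (d k) → r (k+1) = r k / ω₁
  eps_one : ε 1 = ‖gradient f (x 1)‖
  eps_succ_dec : ∀ k, 1 ≤ k → (f (x k + d k) : EReal) ≤ (f (x k) : EReal) + b k →
    ε (k+1) = min (ε k) ‖gradient f (x k + d k)‖
  eps_succ_keep : ∀ k, 1 ≤ k → ¬ ((f (x k + d k) : EReal) ≤ (f (x k) : EReal) + b k) →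
    ε (k+1) = ε k
  b_lb : ∀ k, 1 ≤ k → ((ξ * ε k * ‖d k‖ : ℝ) : EReal) ≤ b k

/-- Near any point, the quadratic model of a `C²` function predicts the gradient up to `O(‖d‖)`
and the function value up to `O(‖d‖²)`. -/
lemma exists_model_error_bound {n : ℕ} {f : EuclideanSpace ℝ (Fin n) → ℝ}
    (hC2 : ContDiff ℝ 2 f) (z : EuclideanSpace ℝ (Fin n)) :
    ∃ C R : ℝ, 0 ≤ C ∧ 0 < R ∧ ∀ x d : EuclideanSpace ℝ (Fin n), dist x z < R → ‖d‖ < R →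
      ‖gradient f (x + d) - gradModel f x d‖ ≤ C * ‖d‖ ∧
      |f (x + d) - f x - modelVal f x d| ≤ C * ‖d‖ ^ 2 := by
  have hdiff : Differentiable ℝ f := hC2.differentiable (by norm_num)
  have hgradC1 : ContDiff ℝ 1 (gradient f) :=
    (InnerProductSpace.toDual ℝ (EuclideanSpace ℝ (Fin n))).symm.contDiff.comp
      (hC2.fderiv_right (by norm_num))
  obtain ⟨K, U, hU, hK⟩ := hgradC1.contDiffAt.exists_lipschitzOnWith (x := z)
  obtain ⟨R, hR, hRU⟩ := Metric.mem_nhds_iff.1 hU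
  have hKball : LipschitzOnWith K (gradient f) (Metric.ball z R) := hK.mono hRU
  refine ⟨2 * K, R / 2, by positivity, by positivity, fun x d hx hd => ?_⟩
  have hxb : x ∈ Metric.ball z R := by
    rw [Metric.mem_ball]; linarith
  have hxdb : x + d ∈ Metric.ball z R := by
    rw [Metric.mem_ball]
    have := dist_triangle (x + d) x z
    rw [dist_self_add_left] at this
    linarith
  have hHess : ‖fderiv ℝ (gradient f) x d‖ ≤ K * ‖d‖ :=
    (fderiv ℝ (gradient f) x).le_of_opNorm_le
      (norm_fderiv_le_of_lipschitzOn ℝ (Metric.isOpen_ball.mem_nhds hxb) hKball) d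
  have hgrad : ∀ y ∈ segment ℝ x (x + d), ‖gradient f y - gradient f x‖ ≤ K * ‖d‖ := by
    intro y hy
    have hyb := (convex_ball z R).segment_subset hxb hxdb hy
    refine (hKball.norm_sub_le hyb hxb).trans ?_
    have := norm_sub_le_of_mem_segment hy
    rw [add_sub_cancel_left] at this
    gcongr
  have hlin : |f (x + d) - f x - ⟪gradient f x, d⟫| ≤ K * ‖d‖ * ‖d‖ := by
    have := (convex_segment x (x + d)).norm_image_sub_le_of_norm_hasFDerivWithin_le'
      (f := f) (f' := fun y => innerSL ℝ (gradient f y)) (φ := innerSL ℝ (gradient f x))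
      (C := K * ‖d‖) (x := x) (y := x + d)
      (fun y _ => ((hdiff y).hasGradientAt.hasFDerivAt).hasFDerivWithinAt)
      (fun y hy => by
        rw [← map_sub, innerSL_apply_norm]
        exact hgrad y hy)
      (left_mem_segment ℝ _ _) (right_mem_segment ℝ _ _)
    simpa using this
  constructor
  · have hsplit : gradient f (x + d) - gradModel f x d
        = (gradient f (x + d) - gradient f x) - fderiv ℝ (gradient f) x d := by
      rw [gradModel]; abel
    rw [hsplit]
    have := norm_sub_le (gradient f (x + d) - gradient f x) (fderiv ℝ (gradient f) x d)
    linarith [hgrad _ (right_mem_segment ℝ x (x + d))]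
  · have hquad : |⟪fderiv ℝ (gradient f) x d, d⟫| ≤ K * ‖d‖ * ‖d‖ :=
      (abs_real_inner_le_norm _ _).trans (by gcongr)
    rw [modelVal]
    rw [abs_le] at hlin hquad ⊢
    have : 0 ≤ K * ‖d‖ * ‖d‖ := by positivity
    constructor <;> nlinarith

/-- If the ratio `ρ̂` is at least `c > 0` and its denominator is nonnegative, then the actual
reduction is at least `c` times the denominator. -/
lemma mul_le_of_le_rhoHat {n : ℕ} {θ c : ℝ} {f : EuclideanSpace ℝ (Fin n) → ℝ}
    {x d : EuclideanSpace ℝ (Fin n)} (hθ : 0 ≤ θ) (hc : 0 < c) (hM : modelVal f x d ≤ 0)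
    (h : c ≤ rhoHat θ f x d) :
    c * (-(modelVal f x d) + (θ/2) * min ‖gradient f x‖ ‖gradient f (x + d)‖ * ‖d‖)
      ≤ f x - f (x + d) := by
  have hden : 0 ≤ -(modelVal f x d)
      + (θ/2) * min ‖gradient f x‖ ‖gradient f (x + d)‖ * ‖d‖ := by
    have : 0 ≤ (θ/2) * min ‖gradient f x‖ ‖gradient f (x + d)‖ * ‖d‖ := by positivity
    linarith
  rw [rhoHat] at h
  rcases hden.eq_or_lt with h0 | hpos
  · rw [← h0, div_zero] at h
    linarith
  · exact (le_div_iff₀ hpos).1 h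

namespace SigmaCATTraj

variable {n : ℕ} {θ β ω₁ ω₂ γ₁ γ₂ γ₃ ξ σ : ℝ} {f : EuclideanSpace ℝ (Fin n) → ℝ}
  {x d : ℕ → EuclideanSpace ℝ (Fin n)} {r δ ε : ℕ → ℝ} {b : ℕ → EReal}

lemma modelVal_nonpos (traj : SigmaCATTraj θ β ω₁ ω₂ γ₁ γ₂ γ₃ ξ σ f x d r δ ε b)
    (hγ₃ : 0 ≤ γ₃) {k : ℕ} (hk : 1 ≤ k) : modelVal f (x k) (d k) ≤ 0 := by
  have := traj.sub_decr k hk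
  have hδ := traj.δ_nonneg k hk
  have : 0 ≤ γ₃ * (δ k / 2) * ‖d k‖ ^ 2 := by positivity
  linarith

lemma f_add_le_of_le_rhoHat (traj : SigmaCATTraj θ β ω₁ ω₂ γ₁ γ₂ γ₃ ξ σ f x d r δ ε b)
    (hγ₃ : 0 ≤ γ₃) (hθ : 0 ≤ θ) {c : ℝ} (hc : 0 < c) {k : ℕ} (hk : 1 ≤ k)
    (h : c ≤ rhoHat θ f (x k) (d k)) : f (x k + d k) ≤ f (x k) := by
  have hM := traj.modelVal_nonpos hγ₃ hk
  have h1 := mul_le_of_le_rhoHat hθ hc hM h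
  have h2 : 0 ≤ c * (-(modelVal f (x k) (d k))
      + (θ/2) * min ‖gradient f (x k)‖ ‖gradient f (x k + d k)‖ * ‖d k‖) := by
    have : 0 ≤ -(modelVal f (x k) (d k)) := by linarith
    positivity
  linarith

lemma eps_succ_le (traj : SigmaCATTraj θ β ω₁ ω₂ γ₁ γ₂ γ₃ ξ σ f x d r δ ε b)
    {k : ℕ} (hk : 1 ≤ k) : ε (k + 1) ≤ ε k := by
  by_cases h : (f (x k + d k) : EReal) ≤ (f (x k) : EReal) + b k
  · rw [traj.eps_succ_dec k hk h]
    exact min_le_left _ _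
  · exact (traj.eps_succ_keep k hk h).le

lemma eps_succ_le_norm_gradient (traj : SigmaCATTraj θ β ω₁ ω₂ γ₁ γ₂ γ₃ ξ σ f x d r δ ε b)
    {k : ℕ} (hk : 1 ≤ k) (h : f (x k + d k) ≤ f (x k) + ξ * ε k * ‖d k‖) :
    ε (k + 1) ≤ ‖gradient f (x k + d k)‖ := by
  have h' : (f (x k + d k) : EReal) ≤ (f (x k) : EReal) + b k := by
    refine (EReal.coe_le_coe_iff.2 h).trans ?_
    rw [EReal.coe_add]
    gcongr
    exact traj.b_lb k hk
  rw [traj.eps_succ_dec k hk h']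
  exact min_le_right _ _

lemma eps_succ_le_norm_gradient_of_f_le
    (traj : SigmaCATTraj θ β ω₁ ω₂ γ₁ γ₂ γ₃ ξ σ f x d r δ ε b) (hξ : 0 ≤ ξ)
    {k : ℕ} (hk : 1 ≤ k) (h : f (x k + d k) ≤ f (x k)) :
    ε (k + 1) ≤ ‖gradient f (x k + d k)‖ := by
  have := (traj.ε_pos k hk).le
  exact traj.eps_succ_le_norm_gradient hk (h.trans (le_add_of_nonneg_right (by positivity)))

lemma eps_le_norm_gradient (traj : SigmaCATTraj θ β ω₁ ω₂ γ₁ γ₂ γ₃ ξ σ f x d r δ ε b)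
    (hξ : 0 ≤ ξ) {k : ℕ} (hk : 1 ≤ k) : ε k ≤ ‖gradient f (x k)‖ := by
  induction k, hk using Nat.le_induction with
  | base => exact traj.eps_one.le
  | succ k hk ih =>
    by_cases h : f (x k + d k) ≤ f (x k) ∧ σ ≤ rhoHat θ f (x k) (d k)
    · rw [traj.step_acc k hk h]
      exact traj.eps_succ_le_norm_gradient_of_f_le hξ hk h.1
    · rw [traj.step_rej k hk h]
      exact (traj.eps_succ_le hk).trans ih

lemma f_succ_le (traj : SigmaCATTraj θ β ω₁ ω₂ γ₁ γ₂ γ₃ ξ σ f x d r δ ε b)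
    {k : ℕ} (hk : 1 ≤ k) : f (x (k + 1)) ≤ f (x k) := by
  by_cases h : f (x k + d k) ≤ f (x k) ∧ σ ≤ rhoHat θ f (x k) (d k)
  · rw [traj.step_acc k hk h]
    exact h.1
  · rw [traj.step_rej k hk h]

/-- Every change of iterate is paid for by a proportional decrease of `f`. -/
lemma mul_dist_le (traj : SigmaCATTraj θ β ω₁ ω₂ γ₁ γ₂ γ₃ ξ σ f x d r δ ε b)
    (hγ₃ : 0 ≤ γ₃) (hθ : 0 ≤ θ) (hξ : 0 ≤ ξ) (hσ : 0 < σ) {e : ℝ}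
    (he : ∀ k, 1 ≤ k → e ≤ ε k) {k : ℕ} (hk : 1 ≤ k) :
    σ * (θ / 2 * e) * dist (x k) (x (k + 1)) ≤ f (x k) - f (x (k + 1)) := by
  by_cases h : f (x k + d k) ≤ f (x k) ∧ σ ≤ rhoHat θ f (x k) (d k)
  · rw [traj.step_acc k hk h, dist_self_add_right]
    have hM := traj.modelVal_nonpos hγ₃ hk
    refine le_trans ?_ (mul_le_of_le_rhoHat hθ hσ hM h.2)
    have hmin : e ≤ min ‖gradient f (x k)‖ ‖gradient f (x k + d k)‖ :=
      le_min ((he k hk).trans (traj.eps_le_norm_gradient hξ hk))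
        ((he (k + 1) (by omega)).trans (traj.eps_succ_le_norm_gradient_of_f_le hξ hk h.1))
    rw [mul_assoc]
    gcongr
    have : θ / 2 * e * ‖d k‖
        ≤ θ / 2 * min ‖gradient f (x k)‖ ‖gradient f (x k + d k)‖ * ‖d k‖ := by gcongr
    linarith
  · rw [traj.step_rej k hk h]
    simp

/-- If the iterates converge and `ε` stays within a factor two of a positive lower bound `e`, then
eventually every sufficiently short trial step is successful and comparable to the radius. -/
lemma exists_short_step_successful
    (traj : SigmaCATTraj θ β ω₁ ω₂ γ₁ γ₂ γ₃ ξ σ f x d r δ ε b) (hC2 : ContDiff ℝ 2 f)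
    (hθ : 0 < θ) (hβ : 0 < β ∧ β < 1) (hγ₃ : 0 < γ₃)
    (hγ₁ : 0 ≤ γ₁ ∧ γ₁ < (1/2) * (1 - β * θ / (γ₃ * (1 - β)))) (hξ : 0 < ξ)
    {e : ℝ} (he0 : 0 < e) (he : ∀ k, 1 ≤ k → e ≤ ε k) (he2 : ∀ᶠ k in atTop, ε k ≤ 2 * e)
    {z : EuclideanSpace ℝ (Fin n)} (hz : Tendsto x atTop (nhds z)) :
    ∃ η > 0, ∀ᶠ k in atTop, ‖d k‖ ≤ η →
      β ≤ rhoHat θ f (x k) (d k) ∧ γ₂ * r k ≤ ‖d k‖ := by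
  obtain ⟨C, R, hC, hR, hCR⟩ := exists_model_error_bound hC2 z
  set A := γ₃ * (1 - β) with hA
  set B := β * θ with hB
  have hApos : 0 < A := mul_pos hγ₃ (by linarith [hβ.2])
  have hBpos : 0 < B := mul_pos hβ.1 hθ
  have hslack : 2 * γ₁ * A < A - B := by
    have h1 : 2 * γ₁ < 1 - B / A := by linarith [hγ₁.2]
    have h2 : (1 - B / A) * A = A - B := by field_simp
    nlinarith
  have hκ : 0 < (A - B - 2 * γ₁ * A) * e := mul_pos (by linarith) he0
  obtain ⟨η, hη, hηR, hηκ, hηξ⟩ : ∃ η > 0, η < R ∧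
      (2 + A) * (C * η) ≤ (A - B - 2 * γ₁ * A) * e ∧ C * η ≤ ξ * e := by
    have hlim : Tendsto (fun η : ℝ => (2 + A) * (C * η)) (nhdsWithin 0 (Set.Ioi 0)) (nhds 0) := by
      refine tendsto_nhdsWithin_of_tendsto_nhds (Continuous.tendsto' (by fun_prop) _ _ (by simp))
    have hlim' : Tendsto (fun η : ℝ => C * η) (nhdsWithin 0 (Set.Ioi 0)) (nhds 0) := by
      refine tendsto_nhdsWithin_of_tendsto_nhds (Continuous.tendsto' (by fun_prop) _ _ (by simp))
    have hR' : ∀ᶠ η : ℝ in nhdsWithin 0 (Set.Ioi 0), η < R :=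
      mem_nhdsWithin_of_mem_nhds (Iio_mem_nhds hR)
    have hpos : ∀ᶠ η : ℝ in nhdsWithin 0 (Set.Ioi 0), 0 < η := self_mem_nhdsWithin
    obtain ⟨η, h1, h2, h3, h4⟩ := (hpos.and <| hR'.and <|
      (hlim.eventually_le_const hκ).and (hlim'.eventually_le_const (mul_pos hξ he0))).exists
    exact ⟨η, h1, h2, h3, h4⟩
  refine ⟨η, hη, ?_⟩
  filter_upwards [he2, hz.eventually (Metric.ball_mem_nhds z hR), eventually_ge_atTop 1]
    with k hk2 hkR hk hdη
  obtain ⟨hgerr, hferr⟩ := hCR (x k) (d k) hkR (hdη.trans_lt hηR)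
  have hekpos := traj.ε_pos k hk
  have hek := he k hk
  have hδ := traj.δ_nonneg k hk
  have hdecr := traj.sub_decr k hk
  have hM := traj.modelVal_nonpos hγ₃.le hk
  have hferr' := (abs_le.1 hferr)
  set D := ‖d k‖ with hD
  have hD0 : 0 ≤ D := norm_nonneg _
  have hCD : C * D ≤ C * η := by gcongr
  have hg_lower : e ≤ ‖gradient f (x k + d k)‖ := by
    refine (he (k + 1) (by omega)).trans (traj.eps_succ_le_norm_gradient hk ?_)
    have h1 : C * D ≤ ξ * ε k := hCD.trans (hηξ.trans (by gcongr))
    have h2 : C * D * D ≤ ξ * ε k * D := by gcongr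
    nlinarith [hferr'.2]
  have hg_upper : ‖gradient f (x k + d k)‖ ≤ γ₁ * ε k + δ k * D + C * D := by
    have hsplit : gradient f (x k + d k)
        = (gradient f (x k + d k) - gradModel f (x k) (d k))
          + (gradModel f (x k) (d k) + δ k • d k) - δ k • d k := by abel
    have h1 := norm_sub_le ((gradient f (x k + d k) - gradModel f (x k) (d k))
          + (gradModel f (x k) (d k) + δ k • d k)) (δ k • d k)
    have h2 := norm_add_le (gradient f (x k + d k) - gradModel f (x k) (d k))
          (gradModel f (x k) (d k) + δ k • d k)
    rw [← hsplit, norm_smul, Real.norm_of_nonneg hδ] at h1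
    linarith [traj.sub_grad k hk]
  have hγε : γ₁ * ε k ≤ 2 * γ₁ * e := by nlinarith [hγ₁.1]
  set t := δ k * D with ht
  have hCD0 : 0 ≤ C * D := by positivity
  have hACD : (2 + A) * (C * D) ≤ (A - B - 2 * γ₁ * A) * e :=
    le_trans (by gcongr) hηκ
  have ht_lower : e - 2 * γ₁ * e - C * D ≤ t := by linarith
  have htpos : 0 < t := by
    have h1 : A * (e - 2 * γ₁ * e - C * D) ≤ A * t := by gcongr
    have h2 : 0 < B * e := by positivity
    have h3 : 0 < A * t := by nlinarith
    exact pos_of_mul_pos_right h3 hApos.le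
  have hDpos : 0 < D := hD0.lt_of_ne' fun h => by simp [ht, h] at htpos
  have hδpos : 0 < δ k := hδ.lt_of_ne' fun h => by simp [ht, h] at htpos
  constructor
  · have hmin : min ‖gradient f (x k)‖ ‖gradient f (x k + d k)‖ ≤ 2 * γ₁ * e + t + C * D :=
      (min_le_right _ _).trans (by linarith)
    have hMlow : γ₃ * (t * D) / 2 ≤ -modelVal f (x k) (d k) := by
      rw [ht]; linarith
    have hMpos : 0 < -modelVal f (x k) (d k) :=
      lt_of_lt_of_le (by positivity) hMlow
    rw [rhoHat, le_div_iff₀ (by positivity)]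
    have hkey : B * (2 * γ₁ * e + t + C * D) + 2 * (C * D) ≤ A * t := by
      have hAB : 0 ≤ A - B := by
        have : 0 ≤ 2 * γ₁ * A := by have := hγ₁.1; positivity
        linarith
      linarith [mul_le_mul_of_nonneg_left ht_lower hAB]
    have hkeyD := mul_le_mul_of_nonneg_right hkey hD0
    have hminD : B * min ‖gradient f (x k)‖ ‖gradient f (x k + d k)‖ * D
        ≤ B * (2 * γ₁ * e + t + C * D) * D := by gcongr
    have hMβ := mul_le_mul_of_nonneg_left hMlow (sub_nonneg.2 hβ.2.le)
    have h1 : (1 - β) * (γ₃ * (t * D) / 2) = A * t * D / 2 := by rw [hA]; ring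
    have h2 : β * (θ / 2 * min ‖gradient f (x k)‖ ‖gradient f (x k + d k)‖ * D)
        = B * min ‖gradient f (x k)‖ ‖gradient f (x k + d k)‖ * D / 2 := by rw [hB]; ring
    rw [h1] at hMβ
    rw [mul_add, h2]
    linarith [hferr'.2]
  · have := traj.sub_comp k hk
    refine le_of_mul_le_mul_left ?_ hδpos
    linarith

/-- Convergent iterates are incompatible with short trial steps being eventually successful. -/
lemma not_tendsto_of_short_step_successful
    (traj : SigmaCATTraj θ β ω₁ ω₂ γ₁ γ₂ γ₃ ξ σ f x d r δ ε b)
    (hθ : 0 ≤ θ) (hβ : 0 < β) (hω₁ : 1 < ω₁) (hω₂ : 0 < ω₂) (hγ₂ : 0 < γ₂) (hγ₃ : 0 ≤ γ₃)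
    (hσβ : σ ≤ β) {η : ℝ} (hη : 0 < η)
    (hshort : ∀ᶠ k in atTop, ‖d k‖ ≤ η → β ≤ rhoHat θ f (x k) (d k) ∧ γ₂ * r k ≤ ‖d k‖)
    (z : EuclideanSpace ℝ (Fin n)) : ¬ Tendsto x atTop (nhds z) := by
  intro hz
  have hstep : Tendsto (fun k => dist (x (k + 1)) (x k)) atTop (nhds 0) := by
    simpa using (hz.comp (tendsto_add_atTop_nat 1)).dist hz
  have hsmall : ∀ c : ℝ, 0 < c → ∀ᶠ k in atTop, β ≤ rhoHat θ f (x k) (d k) → ‖d k‖ < c := by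
    intro c hc
    filter_upwards [hstep.eventually_lt_const hc, eventually_ge_atTop 1] with k hk hk1 hρ
    have hacc := traj.step_acc k hk1
      ⟨traj.f_add_le_of_le_rhoHat hγ₃ hθ hβ hk1 hρ, hσβ.trans hρ⟩
    rwa [hacc, dist_self_add_left] at hk
  obtain ⟨N, hN⟩ := eventually_atTop.1 (hshort.and <| (hsmall η hη).and <|
    (hsmall (η / ω₂) (by positivity)).and <| (hsmall (γ₂ * η) (by positivity)).and
    (eventually_ge_atTop 1))
  have hr_of_success : ∀ k, N ≤ k → β ≤ rhoHat θ f (x k) (d k) → r (k + 1) ≤ η := by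
    intro k hk hρ
    obtain ⟨h1, h2, h3, h4, h5⟩ := hN k hk
    rw [traj.radius_succ k h5 hρ]
    refine max_le ?_ ?_
    · have := (lt_div_iff₀ hω₂).1 (h3 hρ)
      linarith
    · exact le_of_mul_le_mul_left ((h1 (h2 hρ).le).2.trans (h4 hρ).le) hγ₂
  have hsuccess_of_r : ∀ k, N ≤ k → r k ≤ η →
      β ≤ rhoHat θ f (x k) (d k) ∧ γ₂ * r k ≤ ‖d k‖ := by
    intro k hk hr
    obtain ⟨h1, -, -, -, h5⟩ := hN k hk
    exact h1 ((traj.sub_rad k h5).trans hr)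
  obtain ⟨m, hNm, hrm⟩ : ∃ m, N ≤ m ∧ r m ≤ η := by
    by_contra! hcon
    have hfail : ∀ k, N ≤ k → ¬ β ≤ rhoHat θ f (x k) (d k) := fun k hk hρ =>
      absurd (hr_of_success k hk hρ) (not_le.2 (hcon (k + 1) (by omega)))
    have hgeom : ∀ j, r (N + j) = r N * (ω₁⁻¹) ^ j := by
      intro j
      induction j with
      | zero => simp
      | succ j ih =>
        have hj : N ≤ N + j := by omega
        rw [← add_assoc, traj.radius_fail (N + j) (hN _ hj).2.2.2.2 (hfail _ hj), ih, pow_succ]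
        ring
    have hlim : Tendsto (fun j => r N * (ω₁⁻¹) ^ j) atTop (nhds 0) := by
      simpa using (tendsto_pow_atTop_nhds_zero_of_lt_one (by positivity)
        (inv_lt_one_of_one_lt₀ hω₁)).const_mul (r N)
    obtain ⟨j, hj⟩ := (hlim.eventually_lt_const hη).exists
    rw [← hgeom] at hj
    exact absurd hj (not_lt.2 (hcon (N + j) (by omega)).le)
  have hr : ∀ k, m ≤ k → r k ≤ η ∧ r m ≤ r k := by
    intro k hk
    induction k, hk using Nat.le_induction with
    | base => exact ⟨hrm, le_rfl⟩
    | succ k hk ih =>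
      have hNk := hNm.trans hk
      have hρ := (hsuccess_of_r k hNk ih.1).1
      refine ⟨hr_of_success k hNk hρ, ih.2.trans ?_⟩
      rw [traj.radius_succ k (hN k hNk).2.2.2.2 hρ]
      exact le_max_right _ _
  have hrpos := traj.r_pos m (hN m hNm).2.2.2.2
  obtain ⟨k, hk, hmk⟩ :=
    ((hsmall (γ₂ * r m) (by positivity)).and (eventually_ge_atTop m)).exists
  obtain ⟨hρ, hrd⟩ := hsuccess_of_r k (hNm.trans hmk) (hr k hmk).1
  have hmono : γ₂ * r m ≤ γ₂ * r k := by gcongr; exact (hr k hmk).2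
  linarith [hk hρ]

/-- If `ε` is bounded below by a positive constant and `f` converges along the iterates, then the
iterates converge. -/
lemma exists_tendsto_of_tendsto_f (traj : SigmaCATTraj θ β ω₁ ω₂ γ₁ γ₂ γ₃ ξ σ f x d r δ ε b)
    (hγ₃ : 0 ≤ γ₃) (hθ : 0 < θ) (hξ : 0 ≤ ξ) (hσ : 0 < σ) {e : ℝ} (he0 : 0 < e)
    (he : ∀ k, 1 ≤ k → e ≤ ε k) {L : ℝ}
    (hL : Tendsto (fun k => f (x (k + 1))) atTop (nhds L)) :
    ∃ z, Tendsto x atTop (nhds z) := by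
  have hc : 0 < σ * (θ / 2 * e) := by positivity
  have hanti : Antitone fun k => f (x (k + 1)) :=
    antitone_nat_of_succ_le fun k => traj.f_succ_le (by omega)
  have hsum : Summable fun k => dist (x (k + 1)) (x (k + 1 + 1)) := by
    refine summable_of_sum_range_le (c := (f (x 1) - L) / (σ * (θ / 2 * e)))
      (fun _ => dist_nonneg) fun N => ?_
    rw [le_div_iff₀' hc, Finset.mul_sum]
    calc ∑ k ∈ Finset.range N, σ * (θ / 2 * e) * dist (x (k + 1)) (x (k + 1 + 1))
        ≤ ∑ k ∈ Finset.range N, (f (x (k + 1)) - f (x (k + 1 + 1))) :=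
          Finset.sum_le_sum fun k _ => traj.mul_dist_le hγ₃ hθ.le hξ hσ he (by omega)
      _ = f (x 1) - f (x (N + 1)) := Finset.sum_range_sub' (fun k => f (x (k + 1))) N
      _ ≤ f (x 1) - L := by linarith [hanti.le_of_tendsto hL N]
  obtain ⟨z, hz⟩ := cauchySeq_tendsto_of_complete
    (cauchySeq_of_summable_dist (f := fun k => x (k + 1)) hsum)
  exact ⟨z, (tendsto_add_atTop_iff_nat 1).1 hz⟩

end SigmaCATTraj

/-- Theorem 2: for a σ-CAT trajectory on a twice continuously
differentiable function with locally Lipschitz second derivative, either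
`ε_k → 0` or `f(x_k) → −∞`. -/
theorem locally_lipschitz_convergence {n : ℕ} (hn : 1 ≤ n) (θ β ω₁ ω₂ γ₁ γ₂ γ₃ ξ σ : ℝ)
    (hθ : 0 < θ ∧ θ < 1) (hβ : 0 < β ∧ β < 1)
    (hω₁ : 1 < ω₁) (hω₂ : ω₁ ≤ ω₂)
    (hγ₃ : 0 < γ₃ ∧ γ₃ ≤ 1) (hγ₂ : ω₁⁻¹ < γ₂ ∧ γ₂ ≤ 1)
    (hγ₁ : 0 ≤ γ₁ ∧ γ₁ < (1/2) * (1 - β * θ / (γ₃ * (1 - β))))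
    (hξ : 0 < ξ) (hσ : 0 < σ ∧ σ ≤ β)
    (f : EuclideanSpace ℝ (Fin n) → ℝ)
    (x d : ℕ → EuclideanSpace ℝ (Fin n)) (r δ ε : ℕ → ℝ) (b : ℕ → EReal)
    (traj : SigmaCATTraj θ β ω₁ ω₂ γ₁ γ₂ γ₃ ξ σ f x d r δ ε b)
    (hC2 : ContDiff ℝ 2 f)
    (hlocLip : ∀ x₀ : EuclideanSpace ℝ (Fin n), ∃ U ∈ nhds x₀, ∃ K : NNReal,
      LipschitzOnWith K (fun y => fderiv ℝ (gradient f) y) U) :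
    Tendsto ε atTop (nhds 0) ∨ Tendsto (fun k => f (x k)) atTop atBot := by
  have hε_anti : Antitone fun k => ε (k + 1) :=
    antitone_nat_of_succ_le fun k => traj.eps_succ_le (by omega)
  have hf_anti : Antitone fun k => f (x (k + 1)) :=
    antitone_nat_of_succ_le fun k => traj.f_succ_le (by omega)
  rcases tendsto_atTop_of_antitone hf_anti with hbot | ⟨L, hL⟩
  · exact Or.inr ((tendsto_add_atTop_iff_nat 1).1 hbot)
  refine Or.inl ?_
  obtain ⟨e, hε⟩ : ∃ e, Tendsto (fun k => ε (k + 1)) atTop (nhds e) := by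
    refine (tendsto_atTop_of_antitone hε_anti).resolve_left fun h => ?_
    obtain ⟨k, hk⟩ := (h.eventually_lt_atBot 0).exists
    exact absurd (traj.ε_pos (k + 1) (by omega)) (not_lt.2 hk.le)
  have he_nonneg : 0 ≤ e := ge_of_tendsto' hε fun k => (traj.ε_pos (k + 1) (by omega)).le
  have hε' : Tendsto ε atTop (nhds e) := (tendsto_add_atTop_iff_nat 1).1 hε
  rcases he_nonneg.eq_or_lt with rfl | he0
  · exact hε'
  exfalso
  have he : ∀ k, 1 ≤ k → e ≤ ε k := fun k hk => by
    obtain ⟨j, rfl⟩ := Nat.exists_eq_add_of_le' hk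
    exact hε_anti.le_of_tendsto hε j
  obtain ⟨z, hz⟩ := traj.exists_tendsto_of_tendsto_f hγ₃.1.le hθ.1 hξ.le hσ.1 he0 he hL
  obtain ⟨η, hη, hshort⟩ := traj.exists_short_step_successful hC2 hθ.1 hβ hγ₃.1 hγ₁ hξ he0 he
    (hε'.eventually_le_const (by linarith)) hz
  have hω₁_pos : 0 < ω₁ := zero_lt_one.trans hω₁
  exact traj.not_tendsto_of_short_step_successful hθ.1.le hβ.1 hω₁ (hω₁_pos.trans_le hω₂)
    ((inv_pos.2 hω₁_pos).trans hγ₂.1) hγ₃.1.le hσ.2 hη hshort z hz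
end
end

section
/- Let f : ℝⁿ → ℝ be continuously differentiable and consider gradient descent with the Armijo rule: given η₀ ∈ (0,∞), c ∈ (0,1), μ ∈ (0,1) and x₁ ∈ ℝⁿ, for each k ≥ 1 set S_k := {i ∈ ℕ, i ≥ 0 : f(x_k − η_{k−1}μⁱ∇f(x_k)) ≤ f(x_k) − c·η_{k−1}μⁱ‖∇f(x_k)‖²}, η_k := η_{k−1}·μ^{min S_k} (the set S_k is nonempty), and x_{k+1} := x_k − η_k∇f(x_k). Then either inf_{k ≥ 1} ‖∇f(x_k)‖ = 0 or lim_{k→∞} f(x_k) = −∞. -/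
open Filter

section ArmijoCondition

variable {E : Type*} [NormedAddCommGroup E] [InnerProductSpace ℝ E] [CompleteSpace E]

lemma ContDiff.continuous_gradient {f : E → ℝ} (hf : ContDiff ℝ 1 f) :
    Continuous (gradient f) :=
  (InnerProductSpace.toDual ℝ E).symm.continuous.comp (hf.continuous_fderiv one_ne_zero)

/-- Near a noncritical point of a `C¹` function, all sufficiently small step sizes satisfy the
Armijo condition, uniformly in the base point. -/
lemma ContDiff.eventually_armijo {f : E → ℝ} (hf : ContDiff ℝ 1 f) {c : ℝ} (hc : c < 1) {p : E}
    (hp : gradient f p ≠ 0) :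
    ∀ᶠ q : E × ℝ in nhds (p, 0), 0 ≤ q.2 →
      f (q.1 - q.2 • gradient f q.1) ≤ f q.1 - c * q.2 * ‖gradient f q.1‖ ^ 2 := by
  have hg := hf.continuous_gradient
  have hpos : 0 < ‖gradient f p‖ := norm_pos_iff.mpr hp
  have hstrict : HasStrictFDerivAt f (fderiv ℝ f p) p :=
    hf.contDiffAt.hasStrictFDerivAt one_ne_zero
  have hε : 0 < (1 - c) * ‖gradient f p‖ / 2 := by
    have := sub_pos.mpr hc
    positivity
  have hlin := hstrict.isLittleO.def hε
  have hcont : Continuous fun q : E × ℝ => (q.1 - q.2 • gradient f q.1, q.1) := by fun_prop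
  have hlim : Tendsto (fun q : E × ℝ => (q.1 - q.2 • gradient f q.1, q.1)) (nhds (p, 0))
      (nhds (p, p)) := by
    simpa using hcont.tendsto (p, 0)
  have hcont' : Continuous fun q : E × ℝ =>
      -Inner.inner ℝ (gradient f p) (gradient f q.1)
        + (1 - c) * ‖gradient f p‖ / 2 * ‖gradient f q.1‖ + c * ‖gradient f q.1‖ ^ 2 := by
    fun_prop
  have hneg : ∀ᶠ q : E × ℝ in nhds (p, 0),
      -Inner.inner ℝ (gradient f p) (gradient f q.1)
        + (1 - c) * ‖gradient f p‖ / 2 * ‖gradient f q.1‖ + c * ‖gradient f q.1‖ ^ 2 < 0 := by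
    refine hcont'.continuousAt.eventually_lt continuousAt_const ?_
    simp only [real_inner_self_eq_norm_sq]
    nlinarith [mul_pos hε hpos]
  filter_upwards [hlim.eventually hlin, hneg] with q hq hq' ht
  have hinner : fderiv ℝ f p (gradient f q.1) = Inner.inner ℝ (gradient f p) (gradient f q.1) := by
    simp [gradient]
  have hdiff : q.1 - q.2 • gradient f q.1 - q.1 = -(q.2 • gradient f q.1) := by abel
  simp only [hdiff, map_neg, map_smul, norm_neg, norm_smul, hinner, Real.norm_eq_abs,
    abs_of_nonneg ht, smul_eq_mul] at hq
  have h₁ := (le_abs_self _).trans hq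
  have h₂ := mul_nonpos_of_nonneg_of_nonpos ht hq'.le
  linarith

/-- Backtracking from any positive step size eventually satisfies the Armijo condition. -/
lemma ContDiff.exists_armijo {f : E → ℝ} (hf : ContDiff ℝ 1 f) {c μ t : ℝ} (hc : c < 1)
    (hμ₀ : 0 ≤ μ) (hμ₁ : μ < 1) (ht : 0 ≤ t) (y : E) :
    ∃ i : ℕ, f (y - (t * μ ^ i) • gradient f y) ≤ f y - c * (t * μ ^ i) * ‖gradient f y‖ ^ 2 := by
  by_cases hy : gradient f y = 0
  · exact ⟨0, by simp [hy]⟩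
  have hlim : Tendsto (fun i : ℕ => (y, t * μ ^ i)) atTop (nhds (y, 0)) := by
    refine tendsto_const_nhds.prodMk_nhds ?_
    simpa using (tendsto_pow_atTop_nhds_zero_of_lt_one hμ₀ hμ₁).const_mul t
  obtain ⟨i, hi⟩ := (hlim.eventually (hf.eventually_armijo hc hy)).exists
  exact ⟨i, hi (by positivity)⟩

end ArmijoCondition

/-- Proposition 1: gradient descent with the Armijo rule on a
continuously differentiable function either drives the infimum of the gradient norms
to `0` or drives the objective to `−∞`. Here `sInf S_k` is the least element of the
(nonempty) Armijo set `S_k`. -/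
theorem armijo_gradient_descent {n : ℕ} (hn : 1 ≤ n)
    (f : EuclideanSpace ℝ (Fin n) → ℝ) (hf : ContDiff ℝ 1 f)
    (η₀ c μ : ℝ) (hη₀ : 0 < η₀) (hc : 0 < c ∧ c < 1) (hμ : 0 < μ ∧ μ < 1)
    (x : ℕ → EuclideanSpace ℝ (Fin n)) (η : ℕ → ℝ)
    (hinit : η 0 = η₀)
    (hstep : ∀ k : ℕ, 1 ≤ k →
      η k = η (k-1) * μ ^ sInf {i : ℕ |
        f (x k - (η (k-1) * μ ^ i) • gradient f (x k)) ≤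
          f (x k) - c * (η (k-1) * μ ^ i) * ‖gradient f (x k)‖ ^ 2} ∧
      x (k+1) = x k - η k • gradient f (x k)) :
    (⨅ k : {k : ℕ // 1 ≤ k}, ‖gradient f (x k.1)‖) = 0 ∨
    Tendsto (fun k => f (x k)) atTop atBot := by
  obtain ⟨hc₀, hc₁⟩ := hc
  obtain ⟨hμ₀, hμ₁⟩ := hμ
  have hη : ∀ k, 0 < η k := by
    intro k
    induction k with
    | zero => rwa [hinit]
    | succ k ih =>
      rw [(hstep (k + 1) (by omega)).1]
      exact mul_pos ih (pow_pos hμ₀ _)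
  have hx (k : ℕ) : x (k + 1 + 1) = x (k + 1) - η (k + 1) • gradient f (x (k + 1)) :=
    (hstep (k + 1) (by omega)).2
  have hdec (k : ℕ) :
      f (x (k + 1 + 1)) ≤ f (x (k + 1)) - c * η (k + 1) * ‖gradient f (x (k + 1))‖ ^ 2 := by
    have hmem := Nat.sInf_mem (s := {i : ℕ |
        f (x (k + 1) - (η k * μ ^ i) • gradient f (x (k + 1))) ≤
          f (x (k + 1)) - c * (η k * μ ^ i) * ‖gradient f (x (k + 1))‖ ^ 2})
      (hf.exists_armijo hc₁ hμ₀.le hμ₁ (hη k).le _)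
    have hk := (hstep (k + 1) (by omega)).1
    simp only [Nat.add_sub_cancel] at hk
    rw [Set.mem_ofPred_eq, ← hk] at hmem
    rwa [hx]
  have hanti : Antitone fun k => f (x (k + 1)) := antitone_nat_of_succ_le fun k => by
    have := hdec k
    have : 0 ≤ c * η (k + 1) * ‖gradient f (x (k + 1))‖ ^ 2 :=
      mul_nonneg (mul_nonneg hc₀.le (hη _).le) (sq_nonneg _)
    linarith
  rcases tendsto_atTop_of_antitone hanti with hbot | ⟨l, hl⟩
  · exact Or.inr ((tendsto_add_atTop_iff_nat (f := fun k => f (x k)) 1).mp hbot)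
  left
  by_contra hne
  set δ := ⨅ k : {k : ℕ // 1 ≤ k}, ‖gradient f (x k.1)‖
  have hδ : 0 < δ := lt_of_le_of_ne (Real.iInf_nonneg fun _ => norm_nonneg _) (Ne.symm hne)
  have hδle (k : ℕ) : δ ≤ ‖gradient f (x (k + 1))‖ :=
    ciInf_le (f := fun k : {k : ℕ // 1 ≤ k} => ‖gradient f (x k.1)‖)
      ⟨0, by rintro _ ⟨k, rfl⟩; exact norm_nonneg _⟩ ⟨k + 1, by omega⟩
  have hsum : Summable fun k => c * η (k + 1) * ‖gradient f (x (k + 1))‖ ^ 2 := by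
    refine summable_of_sum_range_le (c := f (x 1) - l)
      (fun k => mul_nonneg (mul_nonneg hc₀.le (hη _).le) (sq_nonneg _)) fun N => ?_
    calc ∑ k ∈ Finset.range N, c * η (k + 1) * ‖gradient f (x (k + 1))‖ ^ 2
        ≤ ∑ k ∈ Finset.range N, (f (x (k + 1)) - f (x (k + 1 + 1))) :=
          Finset.sum_le_sum fun k _ => by linarith [hdec k]
      _ = f (x 1) - f (x (N + 1)) := Finset.sum_range_sub' (fun k => f (x (k + 1))) N
      _ ≤ f (x 1) - l := sub_le_sub_left (hanti.le_of_tendsto hl N) _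
  have hlen : Summable fun k => η (k + 1) * ‖gradient f (x (k + 1))‖ := by
    refine Summable.of_nonneg_of_le (fun k => mul_nonneg (hη _).le (norm_nonneg _)) (fun k => ?_)
      (hsum.mul_left (c * δ)⁻¹)
    rw [inv_mul_eq_div, le_div_iff₀ (mul_pos hc₀ hδ)]
    have := mul_le_mul_of_nonneg_left (hδle k)
      (mul_nonneg (mul_nonneg hc₀.le (hη (k + 1)).le) (norm_nonneg (gradient f (x (k + 1)))))
    linarith
  have hηsum : Summable fun k => η (k + 1) := by
    refine Summable.of_nonneg_of_le (fun k => (hη _).le) (fun k => ?_) (hlen.mul_left δ⁻¹)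
    rw [inv_mul_eq_div, le_div_iff₀ hδ]
    exact mul_le_mul_of_nonneg_left (hδle k) (hη _).le
  have hcauchy : CauchySeq fun k => x (k + 1) := by
    refine cauchySeq_of_dist_le_of_summable _ (fun k => ?_) hlen
    rw [Nat.succ_eq_add_one, hx, dist_eq_norm, sub_sub_cancel, norm_smul, Real.norm_eq_abs,
      abs_of_pos (hη _)]
  obtain ⟨p, hp⟩ := cauchySeq_tendsto_of_complete hcauchy
  have hgp : gradient f p ≠ 0 := norm_pos_iff.mp <| hδ.trans_le <|
    ge_of_tendsto' ((hf.continuous_gradient.norm.tendsto p).comp hp) hδle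
  have hη₁ : Tendsto (fun k => η (k + 1)) atTop (nhds 0) := hηsum.tendsto_atTop_zero
  have hlim : Tendsto (fun k => (x (k + 1), η (k + 1) / μ)) atTop (nhds (p, 0)) :=
    hp.prodMk_nhds (by simpa using hη₁.div_const μ)
  obtain ⟨K, hK⟩ := eventually_atTop.mp (hlim.eventually (hf.eventually_armijo hc₁ hgp))
  have hstat : ∀ k ≥ K, η (k + 1) = η k := by
    intro k hk
    have harm := hK k hk (div_nonneg (hη _).le hμ₀.le)
    have hs := (hstep (k + 1) (by omega)).1
    simp only [Nat.add_sub_cancel] at hs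
    set S := {i : ℕ | f (x (k + 1) - (η k * μ ^ i) • gradient f (x (k + 1))) ≤
      f (x (k + 1)) - c * (η k * μ ^ i) * ‖gradient f (x (k + 1))‖ ^ 2} with hS
    rcases hm : sInf S with _ | m
    · simpa [hm] using hs
    · have hdiv : η (k + 1) / μ = η k * μ ^ m := by
        rw [hs, hm, pow_succ]
        field_simp
      have hmem : m ∈ S := by
        rw [hS, Set.mem_ofPred_eq, ← hdiv]
        exact harm
      have := Nat.sInf_le hmem
      omega
  have hconst : ∀ k ≥ K, η k = η K := fun k hk =>
    Nat.le_induction rfl (fun j hj ih => (hstat j hj).trans ih) k hk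
  have hK₀ : η K = 0 := tendsto_nhds_unique
    (tendsto_const_nhds.congr' (eventually_atTop.mpr
      ⟨K, fun k hk => (hconst (k + 1) (by omega)).symm⟩)) hη₁
  exact (hη K).ne' hK₀
end

section
/- Let n ≥ 1, H a symmetric n×n real matrix, g, g', d ∈ ℝⁿ, φ, φ' ∈ ℝ, L ∈ (0,∞), r ∈ (0,∞), δ ∈ [0,∞), ε ∈ (0,∞), and define M(d) := (1/2)dᵀHd + gᵀd and ∇M(d) := Hd + g. Assume: ‖g'‖ ≤ ‖∇M(d)‖ + (L/2)‖d‖²; φ' ≤ φ + M(d) + (L/6)‖d‖³; ‖∇M(d) + δd‖ ≤ γ₁ε; γ₂δr ≤ δ‖d‖; ‖d‖ ≤ r; and M(d) ≤ −γ₃(δ/2)‖d‖². If either ‖d‖ < γ₂r or φ − φ' < β·(−M(d) + (θ/2)·min{‖g‖, ‖g'‖}·‖d‖), then ‖g'‖ ≤ c₁L‖d‖² + c₂‖∇M(d) + δd‖. -/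
open scoped RealInnerProductSpace

/-- Solving the linear inequality `A G ≤ A e + B G + (1/3 + A/2) y` for `G`. -/
theorem le_of_mul_le_add_mul {A B G e y : ℝ} (hAB : B < A)
    (h : A * G ≤ A * e + B * G + (1/3 + A/2) * y) :
    G ≤ ((2 + 3 * A) / (6 * (A - B))) * y + (A / (A - B)) * e := by
  have hpos : 0 < A - B := sub_pos.mpr hAB
  have heq : ((2 + 3 * A) / (6 * (A - B))) * y + (A / (A - B)) * e =
      ((1/3 + A/2) * y + A * e) / (A - B) := by
    field_simp
    ring
  rw [heq, le_div_iff₀ hpos]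
  linarith

/-- Lemma 1, stated abstractly: if the subproblem solution is interior
(`‖d‖ < γ₂ r`) or the step is unsuccessful (`ρ̂ < β`), then the next gradient norm is
bounded by `c₁ L ‖d‖² + c₂ ‖∇M(d) + δ d‖`. -/
theorem gradient_bound_distance {n : ℕ} (hn : 1 ≤ n)
    (θ β ω₁ ω₂ γ₁ γ₂ γ₃ : ℝ)
    (hθ : 0 < θ ∧ θ < 1) (hβ : 0 < β ∧ β < 1)
    (hω₁ : 1 < ω₁) (hω₂ : ω₁ ≤ ω₂)
    (hγ₃ : 0 < γ₃ ∧ γ₃ ≤ 1) (hγ₂ : ω₁⁻¹ < γ₂ ∧ γ₂ ≤ 1)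
    (hγ₁ : 0 ≤ γ₁ ∧ γ₁ < (1/2) * (1 - β * θ / (γ₃ * (1 - β))))
    (H : Matrix (Fin n) (Fin n) ℝ) (hH : H.IsSymm)
    (g g' d : EuclideanSpace ℝ (Fin n)) (φ φ' L r δ ε : ℝ)
    (hL : 0 < L) (hr : 0 < r) (hδ : 0 ≤ δ) (hε : 0 < ε)
    (hgrad : ‖g'‖ ≤ ‖Matrix.toEuclideanLin H d + g‖ + (L/2) * ‖d‖ ^ 2)
    (hdecr : φ' ≤ φ + ((1/2) * ⟪Matrix.toEuclideanLin H d, d⟫ + ⟪g, d⟫) + (L/6) * ‖d‖ ^ 3)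
    (hsub_grad : ‖Matrix.toEuclideanLin H d + g + δ • d‖ ≤ γ₁ * ε)
    (hsub_comp : γ₂ * δ * r ≤ δ * ‖d‖)
    (hsub_rad : ‖d‖ ≤ r)
    (hsub_decr : (1/2) * ⟪Matrix.toEuclideanLin H d, d⟫ + ⟪g, d⟫ ≤ -(γ₃ * (δ/2) * ‖d‖ ^ 2))
    (hcase : ‖d‖ < γ₂ * r ∨
      φ - φ' < β * (-((1/2) * ⟪Matrix.toEuclideanLin H d, d⟫ + ⟪g, d⟫) +
        (θ/2) * min ‖g‖ ‖g'‖ * ‖d‖)) :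
    ‖g'‖ ≤ ((2 + 3 * γ₃ * (1 - β)) / (6 * (γ₃ * (1 - β) - β * θ))) * L * ‖d‖ ^ 2 +
      (γ₃ * (1 - β) / (γ₃ * (1 - β) - β * θ)) * ‖Matrix.toEuclideanLin H d + g + δ • d‖ := by
  obtain ⟨hθ0, -⟩ := hθ
  obtain ⟨hβ0, hβ1⟩ := hβ
  obtain ⟨hγ₃0, -⟩ := hγ₃
  set m : ℝ := (1/2) * ⟪Matrix.toEuclideanLin H d, d⟫ + ⟪g, d⟫
  have hA : 0 < γ₃ * (1 - β) := mul_pos hγ₃0 (by linarith)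
  have hB : 0 < β * θ := mul_pos hβ0 hθ0
  have hAB : β * θ < γ₃ * (1 - β) := by
    have h : β * θ / (γ₃ * (1 - β)) < 1 := by linarith [hγ₁.1, hγ₁.2]
    rwa [div_lt_one hA] at h
  have hmodel : ‖Matrix.toEuclideanLin H d + g‖ ≤
      ‖Matrix.toEuclideanLin H d + g + δ • d‖ + δ * ‖d‖ := by
    have h := norm_sub_le (Matrix.toEuclideanLin H d + g + δ • d) (δ • d)
    rwa [add_sub_cancel_right, norm_smul, Real.norm_of_nonneg hδ] at h
  have hx := norm_nonneg d
  have hG := norm_nonneg g'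
  set e := ‖Matrix.toEuclideanLin H d + g + δ • d‖
  have hnext : ‖g'‖ ≤ e + δ * ‖d‖ + (L/2) * ‖d‖ ^ 2 := by linarith
  have hy : 0 ≤ L * ‖d‖ ^ 2 := by positivity
  have hstep : γ₃ * (1 - β) * (δ * ‖d‖) ≤ (L/3) * ‖d‖ ^ 2 + β * θ * ‖g'‖ := by
    rcases hcase with hint | hfail
    · have hδ0 : δ = 0 := by
        by_contra hne
        have hδpos : 0 < δ := lt_of_le_of_ne hδ (Ne.symm hne)
        linarith [mul_lt_mul_of_pos_left hint hδpos]
      rw [hδ0]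
      simp only [zero_mul, mul_zero]
      positivity
    · rcases hx.eq_or_lt with h0 | hpos
      · rw [← h0]
        simp only [mul_zero]
        positivity
      · have hmin : β * ((θ/2) * min ‖g‖ ‖g'‖ * ‖d‖) ≤ β * ((θ/2) * ‖g'‖ * ‖d‖) := by
          gcongr
          exact min_le_right _ _
        have hdec : (1 - β) * (γ₃ * (δ/2) * ‖d‖ ^ 2) ≤ (1 - β) * (-m) :=
          mul_le_mul_of_nonneg_left (by linarith) (by linarith)
        refine le_of_mul_le_mul_right ?_ hpos
        linarith
  rw [show (2 + 3 * γ₃ * (1 - β)) = 2 + 3 * (γ₃ * (1 - β)) by ring,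
    mul_assoc _ L]
  refine le_of_mul_le_add_mul hAB ?_
  linarith [mul_le_mul_of_nonneg_left hnext hA.le]
end

section
/- Suppose a CAT trajectory satisfies f(x₁) − f(x_k) ≤ Δ_f for all k (for some Δ_f ∈ (0,∞)). Then for all k ∈ ℕ and all j ≥ k: ω₁^{k−j}·r_k ≤ r_j ≤ max{r_k, d_max(j+1)}, where d_max(m) := (2ω₂/(βθ))·Δ_f/ε_m. -/
open scoped RealInnerProductSpace
open Filter

noncomputable section

/-- A CAT trajectory (Algorithm 1, with `σ = 0`): sequences of iterates `x`, directions `d`,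
radii `r`, multipliers `δ`, gradient-norm estimates `ε` and thresholds `b` (in `(0,∞]`,
modeled as `EReal`), indexed from `k = 1`. -/
structure CATTraj {n : ℕ} (θ β ω₁ ω₂ γ₁ γ₂ γ₃ ξ : ℝ)
    (f : EuclideanSpace ℝ (Fin n) → ℝ)
    (x d : ℕ → EuclideanSpace ℝ (Fin n))
    (r δ ε : ℕ → ℝ) (b : ℕ → EReal) : Prop where
  hf : ∀ y, DifferentiableAt ℝ f y
  hf' : ∀ y, DifferentiableAt ℝ (gradient f) y
  r_pos : ∀ k, 1 ≤ k → 0 < r k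
  δ_nonneg : ∀ k, 1 ≤ k → 0 ≤ δ k
  ε_pos : ∀ k, 1 ≤ k → 0 < ε k
  b_pos : ∀ k, 1 ≤ k → 0 < b k
  sub_grad : ∀ k, 1 ≤ k → ‖gradModel f (x k) (d k) + δ k • d k‖ ≤ γ₁ * ε k
  sub_comp : ∀ k, 1 ≤ k → γ₂ * δ k * r k ≤ δ k * ‖d k‖
  sub_rad : ∀ k, 1 ≤ k → ‖d k‖ ≤ r k
  sub_decr : ∀ k, 1 ≤ k → modelVal f (x k) (d k) ≤ -(γ₃ * (δ k / 2) * ‖d k‖ ^ 2)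
  step_acc : ∀ k, 1 ≤ k → f (x k + d k) ≤ f (x k) → x (k+1) = x k + d k
  step_rej : ∀ k, 1 ≤ k → ¬ f (x k + d k) ≤ f (x k) → x (k+1) = x k
  radius_succ : ∀ k, 1 ≤ k → β ≤ rhoHat θ f (x k) (d k) →
    r (k+1) = max (ω₂ * ‖d k‖) (r k)
  radius_fail : ∀ k, 1 ≤ k → ¬ β ≤ rhoHat θ f (x k) (d k) → r (k+1) = r k / ω₁
  eps_one : ε 1 = ‖gradient f (x 1)‖
  eps_succ_dec : ∀ k, 1 ≤ k → (f (x k + d k) : EReal) ≤ (f (x k) : EReal) + b k →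
    ε (k+1) = min (ε k) ‖gradient f (x k + d k)‖
  eps_succ_keep : ∀ k, 1 ≤ k → ¬ ((f (x k + d k) : EReal) ≤ (f (x k) : EReal) + b k) →
    ε (k+1) = ε k
  b_lb : ∀ k, 1 ≤ k → ((ξ * ε k * ‖d k‖ : ℝ) : EReal) ≤ b k

/-- Assumption 1: bounded optimality gap along the trajectory, and the two
Lipschitz-Hessian-type inequalities along the steps. -/
def Assumption1 {n : ℕ} (L Δf : ℝ) (f : EuclideanSpace ℝ (Fin n) → ℝ)
    (x d : ℕ → EuclideanSpace ℝ (Fin n)) : Prop :=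
  ∀ k, 1 ≤ k →
    f (x 1) - f (x k) ≤ Δf ∧
    ‖gradient f (x k + d k)‖ ≤ ‖gradModel f (x k) (d k)‖ + (L/2) * ‖d k‖ ^ 2 ∧
    f (x k + d k) ≤ f (x k) + modelVal f (x k) (d k) + (L/6) * ‖d k‖ ^ 3

/-- `c₁ := (2 + 3γ₃(1−β))/(6(γ₃(1−β) − βθ))`. -/
def c1Def (θ β γ₃ : ℝ) : ℝ := (2 + 3 * γ₃ * (1 - β)) / (6 * (γ₃ * (1 - β) - β * θ))

/-- `c₂ := γ₃(1−β)/(γ₃(1−β) − βθ)`. -/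
def c2Def (θ β γ₃ : ℝ) : ℝ := γ₃ * (1 - β) / (γ₃ * (1 - β) - β * θ)

/-- `C := max{1/(3ξ), 2c₁/(1 − 2γ₁c₂)}`. -/
def CDef (θ β γ₃ γ₁ ξ : ℝ) : ℝ :=
  max (1 / (3 * ξ)) (2 * c1Def θ β γ₃ / (1 - 2 * γ₁ * c2Def θ β γ₃))

/-- `d_min` as a function of the value `e = ε_k`:
`γ₂ ω₁⁻¹ C^{-1/2} L^{-1/2} e^{1/2}`. -/
def dminDef (γ₂ ω₁ C L e : ℝ) : ℝ :=
  γ₂ * ω₁⁻¹ * (Real.sqrt C)⁻¹ * (Real.sqrt L)⁻¹ * Real.sqrt e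

/-- `d_max` as a function of the value `e = ε_k`: `(2ω₂/(βθ)) Δf / e`. -/
def dmaxDef (ω₂ β θ Δf e : ℝ) : ℝ := (2 * ω₂ / (β * θ)) * (Δf / e)

namespace CATTraj

variable {n : ℕ} {θ β ω₁ ω₂ γ₁ γ₂ γ₃ ξ : ℝ} {f : EuclideanSpace ℝ (Fin n) → ℝ}
  {x d : ℕ → EuclideanSpace ℝ (Fin n)} {r δ ε : ℕ → ℝ} {b : ℕ → EReal}

/-- The objective is nonincreasing along the iterates. -/
theorem f_succ_le (traj : CATTraj θ β ω₁ ω₂ γ₁ γ₂ γ₃ ξ f x d r δ ε b) {k : ℕ} (hk : 1 ≤ k) :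
    f (x (k + 1)) ≤ f (x k) := by
  by_cases h : f (x k + d k) ≤ f (x k)
  · rwa [traj.step_acc k hk h]
  · rw [traj.step_rej k hk h]

theorem f_le_f_one (traj : CATTraj θ β ω₁ ω₂ γ₁ γ₂ γ₃ ξ f x d r δ ε b) {k : ℕ} (hk : 1 ≤ k) :
    f (x k) ≤ f (x 1) := by
  induction k, hk using Nat.le_induction with
  | base => exact le_rfl
  | succ k hk ih => exact (traj.f_succ_le hk).trans ih

theorem ε_succ_le (traj : CATTraj θ β ω₁ ω₂ γ₁ γ₂ γ₃ ξ f x d r δ ε b) {k : ℕ} (hk : 1 ≤ k) :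
    ε (k + 1) ≤ ε k := by
  by_cases h : (f (x k + d k) : EReal) ≤ (f (x k) : EReal) + b k
  · rw [traj.eps_succ_dec k hk h]
    exact min_le_left _ _
  · rw [traj.eps_succ_keep k hk h]

/-- A trial point that does not increase the objective updates the gradient estimate. -/
theorem ε_succ_of_le (traj : CATTraj θ β ω₁ ω₂ γ₁ γ₂ γ₃ ξ f x d r δ ε b) {k : ℕ} (hk : 1 ≤ k)
    (h : f (x k + d k) ≤ f (x k)) : ε (k + 1) = min (ε k) ‖gradient f (x k + d k)‖ :=
  traj.eps_succ_dec k hk <| (EReal.coe_le_coe_iff.2 h).trans <|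
    le_add_of_nonneg_right (traj.b_pos k hk).le

theorem ε_le_norm_gradient (traj : CATTraj θ β ω₁ ω₂ γ₁ γ₂ γ₃ ξ f x d r δ ε b) {k : ℕ}
    (hk : 1 ≤ k) : ε k ≤ ‖gradient f (x k)‖ := by
  induction k, hk using Nat.le_induction with
  | base => exact traj.eps_one.le
  | succ k hk ih =>
    by_cases h : f (x k + d k) ≤ f (x k)
    · rw [traj.ε_succ_of_le hk h, traj.step_acc k hk h]
      exact min_le_right _ _
    · rw [traj.step_rej k hk h]
      exact (traj.ε_succ_le hk).trans ih

theorem modelVal_nonpos (traj : CATTraj θ β ω₁ ω₂ γ₁ γ₂ γ₃ ξ f x d r δ ε b) (hγ₃ : 0 ≤ γ₃)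
    {k : ℕ} (hk : 1 ≤ k) : modelVal f (x k) (d k) ≤ 0 := by
  have hδ := traj.δ_nonneg k hk
  have h : 0 ≤ γ₃ * (δ k / 2) * ‖d k‖ ^ 2 := by positivity
  linarith [traj.sub_decr k hk]

/-- A successful step decreases the objective at least in proportion to the gradient estimate
times the step length. -/
theorem sufficient_decrease (traj : CATTraj θ β ω₁ ω₂ γ₁ γ₂ γ₃ ξ f x d r δ ε b)
    (hθ : 0 < θ) (hβ : 0 < β) (hγ₃ : 0 ≤ γ₃) {k : ℕ} (hk : 1 ≤ k)
    (hρ : β ≤ rhoHat θ f (x k) (d k)) :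
    β * (θ / 2 * ε (k + 1) * ‖d k‖) ≤ f (x k) - f (x (k + 1)) := by
  have hM := traj.modelVal_nonpos hγ₃ hk
  have hN : 0 ≤ (θ / 2) * min ‖gradient f (x k)‖ ‖gradient f (x k + d k)‖ * ‖d k‖ := by
    positivity
  unfold rhoHat at hρ
  set D := -(modelVal f (x k) (d k)) +
    (θ / 2) * min ‖gradient f (x k)‖ ‖gradient f (x k + d k)‖ * ‖d k‖ with hD
  have hD₀ : D ≠ 0 := fun h => by
    rw [h, div_zero] at hρ
    exact hβ.not_ge hρ
  have hDpos : 0 < D := lt_of_le_of_ne (by linarith) hD₀.symm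
  have hdec : β * D ≤ f (x k) - f (x k + d k) := (le_div_iff₀ hDpos).1 hρ
  have hle : f (x k + d k) ≤ f (x k) := by linarith [mul_pos hβ hDpos]
  have hε : ε (k + 1) ≤ min ‖gradient f (x k)‖ ‖gradient f (x k + d k)‖ := by
    rw [traj.ε_succ_of_le hk hle]
    exact min_le_min_right _ (traj.ε_le_norm_gradient hk)
  rw [traj.step_acc k hk hle]
  refine le_trans ?_ hdec
  have : θ / 2 * ε (k + 1) * ‖d k‖ ≤
      θ / 2 * min ‖gradient f (x k)‖ ‖gradient f (x k + d k)‖ * ‖d k‖ := by gcongr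
  gcongr
  linarith

theorem mul_norm_le_dmaxDef (traj : CATTraj θ β ω₁ ω₂ γ₁ γ₂ γ₃ ξ f x d r δ ε b)
    (hθ : 0 < θ) (hβ : 0 < β) (hω₂ : 0 ≤ ω₂) (hγ₃ : 0 ≤ γ₃) {Δf : ℝ}
    (hbound : ∀ k, 1 ≤ k → f (x 1) - f (x k) ≤ Δf) {k : ℕ} (hk : 1 ≤ k)
    (hρ : β ≤ rhoHat θ f (x k) (d k)) :
    ω₂ * ‖d k‖ ≤ dmaxDef ω₂ β θ Δf (ε (k + 1)) := by
  have hdec := traj.sufficient_decrease hθ hβ hγ₃ hk hρ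
  have hε := traj.ε_pos (k + 1) (by omega)
  have hgap : β * (θ / 2 * ε (k + 1) * ‖d k‖) ≤ Δf := by
    linarith [traj.f_le_f_one hk, hbound (k + 1) (by omega)]
  calc ω₂ * ‖d k‖
      = 2 * ω₂ / (β * θ) * (β * (θ / 2 * ε (k + 1) * ‖d k‖) / ε (k + 1)) := by
        field_simp
    _ ≤ 2 * ω₂ / (β * θ) * (Δf / ε (k + 1)) := by gcongr

theorem dmaxDef_ε_succ_le (traj : CATTraj θ β ω₁ ω₂ γ₁ γ₂ γ₃ ξ f x d r δ ε b)
    (hθ : 0 < θ) (hβ : 0 < β) (hω₂ : 0 ≤ ω₂) {Δf : ℝ} (hΔf : 0 ≤ Δf) {k : ℕ} (hk : 1 ≤ k) :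
    dmaxDef ω₂ β θ Δf (ε k) ≤ dmaxDef ω₂ β θ Δf (ε (k + 1)) := by
  have hε := traj.ε_pos (k + 1) (by omega)
  have hle := traj.ε_succ_le hk
  unfold dmaxDef
  gcongr

theorem div_le_radius_succ (traj : CATTraj θ β ω₁ ω₂ γ₁ γ₂ γ₃ ξ f x d r δ ε b)
    (hω₁ : 1 ≤ ω₁) {k : ℕ} (hk : 1 ≤ k) : r k / ω₁ ≤ r (k + 1) := by
  by_cases h : β ≤ rhoHat θ f (x k) (d k)
  · rw [traj.radius_succ k hk h]
    exact (div_le_self (traj.r_pos k hk).le hω₁).trans (le_max_right _ _)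
  · rw [traj.radius_fail k hk h]

theorem radius_succ_le (traj : CATTraj θ β ω₁ ω₂ γ₁ γ₂ γ₃ ξ f x d r δ ε b)
    (hθ : 0 < θ) (hβ : 0 < β) (hω₁ : 1 ≤ ω₁) (hω₂ : 0 ≤ ω₂) (hγ₃ : 0 ≤ γ₃) {Δf : ℝ}
    (hbound : ∀ k, 1 ≤ k → f (x 1) - f (x k) ≤ Δf) {k : ℕ} (hk : 1 ≤ k) :
    r (k + 1) ≤ max (r k) (dmaxDef ω₂ β θ Δf (ε (k + 1))) := by
  by_cases h : β ≤ rhoHat θ f (x k) (d k)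
  · rw [traj.radius_succ k hk h, max_comm]
    exact max_le_max_left _ (traj.mul_norm_le_dmaxDef hθ hβ hω₂ hγ₃ hbound hk h)
  · rw [traj.radius_fail k hk h]
    exact (div_le_self (traj.r_pos k hk).le hω₁).trans (le_max_left _ _)

end CATTraj

/-- Lemma 2(i): radius bounds along a CAT trajectory with bounded
optimality gap. -/
theorem radius_bounds {n : ℕ} (hn : 1 ≤ n) (θ β ω₁ ω₂ γ₁ γ₂ γ₃ ξ Δf : ℝ)
    (hθ : 0 < θ ∧ θ < 1) (hβ : 0 < β ∧ β < 1)
    (hω₁ : 1 < ω₁) (hω₂ : ω₁ ≤ ω₂)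
    (hγ₃ : 0 < γ₃ ∧ γ₃ ≤ 1) (hγ₂ : ω₁⁻¹ < γ₂ ∧ γ₂ ≤ 1)
    (hγ₁ : 0 ≤ γ₁ ∧ γ₁ < (1/2) * (1 - β * θ / (γ₃ * (1 - β))))
    (hξ : 0 < ξ)
    (f : EuclideanSpace ℝ (Fin n) → ℝ)
    (x d : ℕ → EuclideanSpace ℝ (Fin n)) (r δ ε : ℕ → ℝ) (b : ℕ → EReal)
    (traj : CATTraj θ β ω₁ ω₂ γ₁ γ₂ γ₃ ξ f x d r δ ε b)
    (hΔf : 0 < Δf)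
    (hbound : ∀ k, 1 ≤ k → f (x 1) - f (x k) ≤ Δf) :
    ∀ k : ℕ, 1 ≤ k → ∀ j : ℕ, k ≤ j →
      ω₁ ^ ((k : ℤ) - (j : ℤ)) * r k ≤ r j ∧
      r j ≤ max (r k) (dmaxDef ω₂ β θ Δf (ε (j+1))) := by
  intro k hk j hkj
  have hω₁pos : 0 < ω₁ := by linarith
  have hω₂nonneg : 0 ≤ ω₂ := by linarith
  induction j, hkj using Nat.le_induction with
  | base => simp
  | succ j hkj ih =>
    have hj : 1 ≤ j := hk.trans hkj
    refine ⟨?_, ?_⟩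
    · calc ω₁ ^ ((k : ℤ) - ((j + 1 : ℕ) : ℤ)) * r k
          = ω₁ ^ ((k : ℤ) - (j : ℤ)) * r k / ω₁ := by
            rw [Nat.cast_succ, ← sub_sub, zpow_sub_one₀ hω₁pos.ne']
            ring
        _ ≤ r j / ω₁ := by
            gcongr
            exact ih.1
        _ ≤ r (j + 1) := traj.div_le_radius_succ hω₁.le hj
    · have hmono := traj.dmaxDef_ε_succ_le hθ.1 hβ.1 hω₂nonneg hΔf.le (Nat.le_succ_of_le hj)
      refine (traj.radius_succ_le hθ.1 hβ.1 hω₁.le hω₂nonneg hγ₃.1.le hbound hj).trans ?_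
      exact (max_le ih.2 (le_max_right _ _)).trans (max_le_max_left _ hmono)
end
end

section
/- Suppose a CAT trajectory satisfies Assumption 1 with constants L, Δ_f ∈ (0,∞). Then for all i ∈ ℕ with π(i) < ∞ and all ℓ ∈ ℕ with ℓ ≤ i: r_{π(ℓ)} ≥ ω₁^{3(1−ℓ)}·min{r₁, d_min(π(i))}, where d_min(k) := γ₂ω₁⁻¹C^{−1/2}L^{−1/2}ε_k^{1/2}. -/
open scoped RealInnerProductSpace
open Filter

noncomputable section

/-- One step of the `π` recursion: the least index `m ≥ 1` with `ε_m < ε_p / 2`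
(`⊤` if there is none or if the previous index was `⊤`). -/
def nextPi (ε : ℕ → ℝ) (p : ℕ∞) : ℕ∞ :=
  if p = ⊤ then ⊤
  else sInf ((fun m : ℕ => (m : ℕ∞)) '' {m : ℕ | 1 ≤ m ∧ ε m < ε p.toNat / 2})

/-- `π(1) = 1` and, for `i > 1`, `π(i)` is the least `j` with `ε_j < ε_{π(i−1)}/2`
(`⊤` if none exists). -/
def piIdx (ε : ℕ → ℝ) : ℕ → ℕ∞
  | 0 => 1
  | 1 => 1
  | (i+2) => nextPi ε (piIdx ε (i+1))

/-- `τ(i) := min({j ≥ π(i) : ‖d_j‖ ≥ d_min(π(i))} ∪ {π(i+1)})`. -/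
def tauIdx {n : ℕ} (γ₂ ω₁ C L : ℝ)
    (d : ℕ → EuclideanSpace ℝ (Fin n)) (ε : ℕ → ℝ) (i : ℕ) : ℕ∞ :=
  if piIdx ε i = ⊤ then ⊤
  else
    min
      (sInf ((fun m : ℕ => (m : ℕ∞)) ''
        {j : ℕ | (piIdx ε i).toNat ≤ j ∧
          dminDef γ₂ ω₁ C L (ε (piIdx ε i).toNat) ≤ ‖d j‖}))
      (piIdx ε (i+1))

section

variable {n : ℕ} {θ β ω₁ ω₂ γ₁ γ₂ γ₃ ξ L Δf : ℝ} {f : EuclideanSpace ℝ (Fin n) → ℝ}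
  {x d : ℕ → EuclideanSpace ℝ (Fin n)} {r δ ε : ℕ → ℝ} {b : ℕ → EReal}

lemma CATTraj.eps_antitone (traj : CATTraj θ β ω₁ ω₂ γ₁ γ₂ γ₃ ξ f x d r δ ε b)
    {p q : ℕ} (hp : 1 ≤ p) (hpq : p ≤ q) : ε q ≤ ε p := by
  induction q, hpq using Nat.le_induction with
  | base => exact le_rfl
  | succ k hk ih =>
    refine le_trans ?_ ih
    by_cases h : (f (x k + d k) : EReal) ≤ (f (x k) : EReal) + b k
    · rw [traj.eps_succ_dec k (hp.trans hk) h]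
      exact min_le_left _ _
    · rw [traj.eps_succ_keep k (hp.trans hk) h]

lemma CATTraj.radius_div_le_succ (traj : CATTraj θ β ω₁ ω₂ γ₁ γ₂ γ₃ ξ f x d r δ ε b)
    (hω₁ : 1 < ω₁) {k : ℕ} (hk : 1 ≤ k) : r k / ω₁ ≤ r (k + 1) := by
  by_cases h : β ≤ rhoHat θ f (x k) (d k)
  · rw [traj.radius_succ k hk h]
    exact (div_le_self (traj.r_pos k hk).le hω₁.le).trans (le_max_right _ _)
  · rw [traj.radius_fail k hk h]

/-- A step whose reduction ratio falls below `β` has its predicted decrease controlled by the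
cubic model error and the trial gradient. -/
lemma model_decrease_le_of_rhoHat_lt {y s : EuclideanSpace ℝ (Fin n)}
    (hθ : 0 < θ) (hβ : 0 < β) (hL : 0 < L)
    (hM : modelVal f y s ≤ 0)
    (hT : f (y + s) ≤ f y + modelVal f y s + (L / 6) * ‖s‖ ^ 3)
    (hρ : rhoHat θ f y s < β) :
    (1 - β) * -modelVal f y s ≤
      L / 6 * ‖s‖ ^ 3 + β * θ / 2 * ‖gradient f (y + s)‖ * ‖s‖ := by
  have hmin : min ‖gradient f y‖ ‖gradient f (y + s)‖ * ‖s‖ ≤ ‖gradient f (y + s)‖ * ‖s‖ := by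
    gcongr
    exact min_le_right _ _
  have hmin0 : 0 ≤ min ‖gradient f y‖ ‖gradient f (y + s)‖ * ‖s‖ := by positivity
  have hprod : 0 ≤ θ / 2 * min ‖gradient f y‖ ‖gradient f (y + s)‖ * ‖s‖ := by positivity
  have hscaled := mul_le_mul_of_nonneg_left hmin (by positivity : 0 ≤ β * θ / 2)
  unfold rhoHat at hρ
  rcases (add_nonneg (neg_nonneg.2 hM) hprod).eq_or_lt with h0 | h0
  · have hM0 : modelVal f y s = 0 := by linarith
    rw [hM0]
    simp only [neg_zero, mul_zero]
    positivity
  · rw [div_lt_iff₀ h0] at hρ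
    linarith

/-- If the trust region is inactive or the reduction ratio falls below `β`, the trial gradient is
bounded by `c₂ γ₁ ε_k + c₁ L ‖d_k‖²`. -/
lemma CATTraj.norm_gradient_trial_le (traj : CATTraj θ β ω₁ ω₂ γ₁ γ₂ γ₃ ξ f x d r δ ε b)
    (hθ : 0 < θ) (hβ : 0 < β ∧ β < 1) (hγ₃ : 0 < γ₃)
    (hgap : β * θ < γ₃ * (1 - β)) (hL : 0 < L) (hA : Assumption1 L Δf f x d)
    {k : ℕ} (hk : 1 ≤ k)
    (h : rhoHat θ f (x k) (d k) < β ∨ ‖d k‖ < γ₂ * r k) :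
    ‖gradient f (x k + d k)‖ ≤
      c2Def θ β γ₃ * (γ₁ * ε k) + c1Def θ β γ₃ * (L * ‖d k‖ ^ 2) := by
  obtain ⟨-, hgrad, hval⟩ := hA k hk
  have hδ := traj.δ_nonneg k hk
  have hβ1 : 0 < 1 - β := by linarith [hβ.2]
  set g := ‖gradient f (x k + d k)‖
  have hg0 : 0 ≤ g := norm_nonneg _
  have hs0 : 0 ≤ ‖d k‖ := norm_nonneg _
  have hgM : ‖gradModel f (x k) (d k)‖ ≤ γ₁ * ε k + δ k * ‖d k‖ := by
    have h1 := norm_sub_le (gradModel f (x k) (d k) + δ k • d k) (δ k • d k)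
    rw [add_sub_cancel_right, norm_smul, Real.norm_of_nonneg hδ] at h1
    linarith [traj.sub_grad k hk]
  have hkey : γ₃ * (1 - β) * (δ k * ‖d k‖) ≤ L / 3 * ‖d k‖ ^ 2 + β * θ * g := by
    have hrhs : 0 ≤ L / 3 * ‖d k‖ ^ 2 + β * θ * g := by
      have := hβ.1
      positivity
    rcases h with hρ | hs
    · have hdec := traj.sub_decr k hk
      have hM : modelVal f (x k) (d k) ≤ 0 := by
        have : 0 ≤ γ₃ * (δ k / 2) * ‖d k‖ ^ 2 := by positivity
        linarith
      have h1 := model_decrease_le_of_rhoHat_lt hθ hβ.1 hL hM hval hρ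
      have h2 := mul_le_mul_of_nonneg_left hdec hβ1.le
      rcases hs0.eq_or_lt with h0 | h0
      · rw [← h0] at hrhs ⊢
        simpa using hrhs
      · refine le_of_mul_le_mul_right ?_ h0
        linarith
    · have hδ0 : δ k = 0 := by
        by_contra hne
        have hpos : 0 < δ k := lt_of_le_of_ne hδ (Ne.symm hne)
        have := traj.sub_comp k hk
        have := mul_lt_mul_of_pos_left hs hpos
        linarith
      simpa [hδ0] using hrhs
  have hden : 0 < γ₃ * (1 - β) - β * θ := by linarith
  have hrew : c2Def θ β γ₃ * (γ₁ * ε k) + c1Def θ β γ₃ * (L * ‖d k‖ ^ 2) =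
      (γ₃ * (1 - β) * (γ₁ * ε k) + (1 / 3 + γ₃ * (1 - β) / 2) * (L * ‖d k‖ ^ 2)) /
        (γ₃ * (1 - β) - β * θ) := by
    unfold c1Def c2Def
    field_simp
    ring
  rw [hrew, le_div_iff₀ hden]
  have h3 := mul_le_mul_of_nonneg_left (hgrad.trans (add_le_add_left hgM _))
    (by positivity : 0 ≤ γ₃ * (1 - β))
  linarith

lemma CATTraj.eps_succ_lt_half (traj : CATTraj θ β ω₁ ω₂ γ₁ γ₂ γ₃ ξ f x d r δ ε b)
    (hθ : 0 < θ) (hβ : 0 < β ∧ β < 1) (hγ₃ : 0 < γ₃)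
    (hgap : β * θ < γ₃ * (1 - β)) (hc : 0 < 1 - 2 * γ₁ * c2Def θ β γ₃)
    (hξ : 0 < ξ) (hL : 0 < L) (hA : Assumption1 L Δf f x d) {k : ℕ} (hk : 1 ≤ k)
    (hsmall : CDef θ β γ₃ γ₁ ξ * L * ‖d k‖ ^ 2 < ε k)
    (h : rhoHat θ f (x k) (d k) < β ∨ ‖d k‖ < γ₂ * r k) :
    ε (k + 1) < ε k / 2 := by
  have hLs : 0 ≤ L * ‖d k‖ ^ 2 := by positivity
  have hstep : (f (x k + d k) : EReal) ≤ (f (x k) : EReal) + b k := by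
    have hM : modelVal f (x k) (d k) ≤ 0 := by
      have h1 := traj.sub_decr k hk
      have := traj.δ_nonneg k hk
      have : 0 ≤ γ₃ * (δ k / 2) * ‖d k‖ ^ 2 := by positivity
      linarith
    have h1 : 1 / (3 * ξ) * (L * ‖d k‖ ^ 2) ≤ ε k := by
      have := mul_le_mul_of_nonneg_right (le_max_left (1 / (3 * ξ))
        (2 * c1Def θ β γ₃ / (1 - 2 * γ₁ * c2Def θ β γ₃))) hLs
      unfold CDef at hsmall
      linarith
    have h2 : L * ‖d k‖ ^ 2 ≤ 3 * ξ * ε k := by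
      rw [one_div_mul_eq_div, div_le_iff₀ (by positivity)] at h1
      linarith
    have h3 := mul_le_mul_of_nonneg_right h2 (norm_nonneg (d k))
    have h4 : 0 ≤ ξ * ε k * ‖d k‖ := by
      have := traj.ε_pos k hk
      positivity
    have h5 : f (x k + d k) ≤ f (x k) + ξ * ε k * ‖d k‖ := by
      linarith [(hA k hk).2.2]
    calc (f (x k + d k) : EReal) ≤ ((f (x k) + ξ * ε k * ‖d k‖ : ℝ) : EReal) :=
          EReal.coe_le_coe_iff.2 h5
      _ = (f (x k) : EReal) + ((ξ * ε k * ‖d k‖ : ℝ) : EReal) := EReal.coe_add _ _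
      _ ≤ (f (x k) : EReal) + b k := by
          gcongr
          exact traj.b_lb k hk
  rw [traj.eps_succ_dec k hk hstep]
  refine (min_le_right _ _).trans_lt ?_
  have hg := traj.norm_gradient_trial_le hθ hβ hγ₃ hgap hL hA hk h
  have hc1 : 2 * c1Def θ β γ₃ * (L * ‖d k‖ ^ 2) <
      ε k * (1 - 2 * γ₁ * c2Def θ β γ₃) := by
    have := mul_le_mul_of_nonneg_right (le_max_right (1 / (3 * ξ))
      (2 * c1Def θ β γ₃ / (1 - 2 * γ₁ * c2Def θ β γ₃))) hLs
    have h1 : 2 * c1Def θ β γ₃ / (1 - 2 * γ₁ * c2Def θ β γ₃) * (L * ‖d k‖ ^ 2) < ε k := by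
      unfold CDef at hsmall
      linarith
    rwa [div_mul_eq_mul_div, div_lt_iff₀ hc] at h1
  linarith

lemma dminDef_le_of_le_mul_sq {C e e' s : ℝ} (hγ₂ : γ₂ ≤ 1) (hω₁ : 1 < ω₁) (hC : 0 < C)
    (hL : 0 < L) (hs : 0 ≤ s) (hee : e' ≤ e) (h : e ≤ C * L * s ^ 2) :
    dminDef γ₂ ω₁ C L e' ≤ s / ω₁ := by
  have hω : 0 < ω₁ := by linarith
  have hsq : √e' ≤ √C * √L * s := by
    calc √e' ≤ √(C * L * s ^ 2) := Real.sqrt_le_sqrt (hee.trans h)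
      _ = √C * √L * s := by
        rw [Real.sqrt_mul (by positivity), Real.sqrt_mul hC.le, Real.sqrt_sq hs]
  have hC' := Real.sqrt_pos.2 hC
  have hL' := Real.sqrt_pos.2 hL
  unfold dminDef
  calc γ₂ * ω₁⁻¹ * (√C)⁻¹ * (√L)⁻¹ * √e' ≤ 1 * ω₁⁻¹ * (√C)⁻¹ * (√L)⁻¹ * (√C * √L * s) := by
        gcongr
    _ = s / ω₁ := by field_simp

/-- As long as the gradient estimate has not halved, the radius never drops below a threshold
that it starts above and that `d_min` exceeds; the halving step loses at most a factor `ω₁`. -/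
lemma CATTraj.radius_at_halving (traj : CATTraj θ β ω₁ ω₂ γ₁ γ₂ γ₃ ξ f x d r δ ε b)
    (hθ : 0 < θ) (hβ : 0 < β ∧ β < 1)
    (hω₁ : 1 < ω₁) (hγ₃ : 0 < γ₃) (hγ₂ : γ₂ ≤ 1)
    (hgap : β * θ < γ₃ * (1 - β)) (hc : 0 < 1 - 2 * γ₁ * c2Def θ β γ₃)
    (hξ : 0 < ξ) (hL : 0 < L) (hA : Assumption1 L Δf f x d)
    {p q : ℕ} {R e : ℝ} (hp : 1 ≤ p) (hpq : p < q) (hq : ∀ k, 1 ≤ k → k < q → ε p / 2 ≤ ε k)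
    (he : e ≤ ε p / 2)
    (hR : R ≤ dminDef γ₂ ω₁ (CDef θ β γ₃ γ₁ ξ) L e) (hrp : R ≤ r p) : R / ω₁ ≤ r q := by
  have hC : 0 < CDef θ β γ₃ γ₁ ξ := lt_max_of_lt_left (by positivity)
  have hω : 0 < ω₁ := by linarith
  have main : ∀ k, p ≤ k → k < q → R ≤ r k := by
    intro k hpk
    induction k, hpk using Nat.le_induction with
    | base => exact fun _ => hrp
    | succ k hpk ih =>
      intro hkq
      have hk : 1 ≤ k := hp.trans hpk
      have hrk := ih (by lia)
      have hrpos := traj.r_pos k hk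
      by_cases hsmall : CDef θ β γ₃ γ₁ ξ * L * ‖d k‖ ^ 2 < ε k
      · have hnot : ¬ (rhoHat θ f (x k) (d k) < β ∨ ‖d k‖ < γ₂ * r k) := fun h => by
          have h1 := traj.eps_succ_lt_half hθ hβ hγ₃ hgap hc hξ hL hA hk hsmall h
          have h2 := hq (k + 1) (by lia) hkq
          have h3 := traj.eps_antitone hp hpk
          linarith
        rw [not_or, not_lt, not_lt] at hnot
        rw [traj.radius_succ k hk hnot.1]
        exact hrk.trans (le_max_right _ _)
      · have h1 := dminDef_le_of_le_mul_sq hγ₂ hω₁ hC hL (norm_nonneg (d k))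
          (he.trans (hq k hk (by lia))) (not_lt.1 hsmall)
        have h2 : ‖d k‖ / ω₁ ≤ r k / ω₁ := by
          gcongr
          exact traj.sub_rad k hk
        exact hR.trans (h1.trans (h2.trans (traj.radius_div_le_succ hω₁ hk)))
  obtain ⟨k, rfl⟩ : ∃ k, q = k + 1 := ⟨q - 1, by lia⟩
  have h1 : R / ω₁ ≤ r k / ω₁ := by
    gcongr
    exact main k (by lia) (by lia)
  exact h1.trans (traj.radius_div_le_succ hω₁ (by lia))

lemma nextPi_eq_coe {q : ℕ} {p : ℕ∞} (h : nextPi ε p = q) :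
    p ≠ ⊤ ∧ 1 ≤ q ∧ ε q < ε p.toNat / 2 ∧
      ∀ k, 1 ≤ k → k < q → ε p.toNat / 2 ≤ ε k := by
  unfold nextPi at h
  split_ifs at h with hp
  · exact absurd h.symm (ENat.natCast_ne_top q)
  set S := (fun m : ℕ => (m : ℕ∞)) '' {m : ℕ | 1 ≤ m ∧ ε m < ε p.toNat / 2}
  have hne : S.Nonempty := by
    by_contra hS
    rw [Set.not_nonempty_iff_eq_empty.1 hS, sInf_empty] at h
    exact ENat.natCast_ne_top q h.symm
  obtain ⟨m, ⟨hm, hεm⟩, hmq⟩ := h ▸ csInf_mem hne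
  obtain rfl : m = q := Nat.cast_injective hmq
  refine ⟨hp, hm, hεm, fun k hk hkm => ?_⟩
  by_contra hlt
  have : sInf S ≤ (k : ℕ∞) := sInf_le ⟨k, ⟨hk, not_le.1 hlt⟩, rfl⟩
  rw [h, Nat.cast_le] at this
  lia

lemma piIdx_succ_ne_top {l : ℕ} (hl : 1 ≤ l) (h : piIdx ε (l + 1) ≠ ⊤) :
    piIdx ε l ≠ ⊤ ∧ 1 ≤ (piIdx ε (l + 1)).toNat ∧
      ε (piIdx ε (l + 1)).toNat < ε (piIdx ε l).toNat / 2 ∧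
      ∀ k, 1 ≤ k → k < (piIdx ε (l + 1)).toNat → ε (piIdx ε l).toNat / 2 ≤ ε k := by
  obtain ⟨l, rfl⟩ : ∃ m, l = m + 1 := ⟨l - 1, by lia⟩
  exact nextPi_eq_coe (ENat.natCast_toNat h).symm

lemma one_le_toNat_piIdx {l : ℕ} (hl : 1 ≤ l) (h : piIdx ε l ≠ ⊤) :
    1 ≤ (piIdx ε l).toNat := by
  obtain rfl | hl := hl.eq_or_lt
  · simp [piIdx]
  · obtain ⟨l, rfl⟩ : ∃ m, l = m + 1 := ⟨l - 1, by lia⟩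
    exact (piIdx_succ_ne_top (by lia) h).2.1

lemma CATTraj.toNat_piIdx_lt_succ (traj : CATTraj θ β ω₁ ω₂ γ₁ γ₂ γ₃ ξ f x d r δ ε b)
    {l : ℕ} (hl : 1 ≤ l) (h : piIdx ε (l + 1) ≠ ⊤) :
    (piIdx ε l).toNat < (piIdx ε (l + 1)).toNat := by
  obtain ⟨htop, h1, h2, -⟩ := piIdx_succ_ne_top hl h
  by_contra hle
  have h3 := traj.eps_antitone h1 (not_lt.1 hle)
  have h4 := traj.ε_pos _ (one_le_toNat_piIdx hl htop)
  linarith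

lemma CATTraj.piIdx_mono (traj : CATTraj θ β ω₁ ω₂ γ₁ γ₂ γ₃ ξ f x d r δ ε b)
    {l i : ℕ} (hl : 1 ≤ l) (hli : l ≤ i) (h : piIdx ε i ≠ ⊤) :
    piIdx ε l ≠ ⊤ ∧ (piIdx ε l).toNat ≤ (piIdx ε i).toNat := by
  induction i, hli using Nat.le_induction with
  | base => exact ⟨h, le_rfl⟩
  | succ i hli ih =>
    obtain ⟨h1, h2⟩ := ih (piIdx_succ_ne_top (hl.trans hli) h).1
    exact ⟨h1, h2.trans (traj.toNat_piIdx_lt_succ (hl.trans hli) h).le⟩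

end

/-- claim (17) in the paper: lower bound on the radius at the indices
`π(ℓ)`, `ℓ ≤ i`. -/
theorem radius_at_pi_lower_bound {n : ℕ} (hn : 1 ≤ n) (θ β ω₁ ω₂ γ₁ γ₂ γ₃ ξ L Δf : ℝ)
    (hθ : 0 < θ ∧ θ < 1) (hβ : 0 < β ∧ β < 1)
    (hω₁ : 1 < ω₁) (hω₂ : ω₁ ≤ ω₂)
    (hγ₃ : 0 < γ₃ ∧ γ₃ ≤ 1) (hγ₂ : ω₁⁻¹ < γ₂ ∧ γ₂ ≤ 1)
    (hγ₁ : 0 ≤ γ₁ ∧ γ₁ < (1/2) * (1 - β * θ / (γ₃ * (1 - β))))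
    (hξ : 0 < ξ)
    (f : EuclideanSpace ℝ (Fin n) → ℝ)
    (x d : ℕ → EuclideanSpace ℝ (Fin n)) (r δ ε : ℕ → ℝ) (b : ℕ → EReal)
    (traj : CATTraj θ β ω₁ ω₂ γ₁ γ₂ γ₃ ξ f x d r δ ε b)
    (hL : 0 < L) (hΔf : 0 < Δf) (hA : Assumption1 L Δf f x d) :
    ∀ i : ℕ, 1 ≤ i → piIdx ε i ≠ ⊤ → ∀ l : ℕ, 1 ≤ l → l ≤ i →
      ω₁ ^ (3 * (1 - (l : ℤ))) *
          min (r 1) (dminDef γ₂ ω₁ (CDef θ β γ₃ γ₁ ξ) L (ε (piIdx ε i).toNat)) ≤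
        r (piIdx ε l).toNat := by
  intro i hi hiTop
  have hβ1 : 0 < 1 - β := by linarith [hβ.2]
  have hγβ : 0 < γ₃ * (1 - β) := mul_pos hγ₃.1 hβ1
  have hgap : β * θ < γ₃ * (1 - β) := by
    have : β * θ / (γ₃ * (1 - β)) < 1 := by linarith [hγ₁.1, hγ₁.2]
    rwa [div_lt_one hγβ] at this
  have hc : 0 < 1 - 2 * γ₁ * c2Def θ β γ₃ := by
    have hden : 0 < γ₃ * (1 - β) - β * θ := by linarith
    have h1 : 2 * γ₁ < (γ₃ * (1 - β) - β * θ) / (γ₃ * (1 - β)) := by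
      rw [sub_div, div_self hγβ.ne']
      linarith [hγ₁.2]
    rw [lt_div_iff₀ hγβ] at h1
    rw [c2Def, sub_pos, ← mul_div_assoc, div_lt_one hden]
    exact h1
  set m := min (r 1) (dminDef γ₂ ω₁ (CDef θ β γ₃ γ₁ ξ) L (ε (piIdx ε i).toNat)) with hm
  have hω : 0 < ω₁ := by linarith
  have hγ₂0 : 0 < γ₂ := (inv_pos.2 hω).trans hγ₂.1
  have hm0 : 0 ≤ m := by
    refine le_min (traj.r_pos 1 le_rfl).le ?_
    unfold dminDef
    positivity
  intro l hl
  induction l, hl using Nat.le_induction with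
  | base =>
    intro _
    simp [piIdx, hm]
  | succ l hl ih =>
    intro hli
    obtain ⟨hlTop, hle⟩ := traj.piIdx_mono (by lia) hli hiTop
    obtain ⟨hpTop, hq1, hq2, hq3⟩ := piIdx_succ_ne_top hl hlTop
    have hε := traj.eps_antitone hq1 hle
    have hR : ω₁ ^ (3 * (1 - (l : ℤ))) * m ≤
        dminDef γ₂ ω₁ (CDef θ β γ₃ γ₁ ξ) L (ε (piIdx ε i).toNat) :=
      (mul_le_of_le_one_left hm0 (zpow_le_one_of_nonpos₀ hω₁.le (by lia))).trans
        (min_le_right _ _)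
    have h1 := traj.radius_at_halving hθ.1 hβ hω₁ hγ₃.1 hγ₂.2 hgap hc hξ hL hA
      (one_le_toNat_piIdx hl hpTop) (traj.toNat_piIdx_lt_succ hl hlTop) hq3
      (by linarith) hR (ih (by lia))
    refine le_trans ?_ h1
    rw [div_eq_mul_inv, mul_right_comm, ← zpow_sub_one₀ hω.ne']
    gcongr
    · exact hω₁.le
    · push_cast
      lia
end
end
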